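/- Let A = (a_{ij}) be a non-negative, ordered, symmetric, homogeneous integer matrix of odd size (2k−1)×(2k−1), with k > 1. For a general choice of k skew-symmetric matrices G_1, …, G_k of homogeneous forms in four variables with degree matrix A, let I be the ideal of R = ℂ[x1,x2,x3,x4] generated by the submaximal Pfaffians of all the G_i. Then multiplication by a general linear form L gives a surjection (R/I)_{d−1} → (R/I)_d for all d ≥ (a_{11} + tr(A))/2. -/

import Mathlib

open MvPolynomial

/-- The Pfaffian of a `2n × 2n` matrix of multivariate polynomials over `ℂ`,
given by the standard averaged signed sum over permutations. -/
noncomputable def pfaff {σ : Type*} {n : ℕ}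
    (M : Matrix (Fin (2*n)) (Fin (2*n)) (MvPolynomial σ ℂ)) : MvPolynomial σ ℂ :=
  (((2^n * n.factorial : ℕ) : ℂ)⁻¹) •
    ∑ p : Equiv.Perm (Fin (2*n)),
      (Equiv.Perm.sign p : ℤ) •
        ∏ i : Fin n, M (p ⟨2*i.1, by have := i.2; omega⟩) (p ⟨2*i.1+1, by have := i.2; omega⟩)

/-- A square matrix of polynomials is skew-symmetric. -/
def IsSkew {m : Type*} {R : Type*} [Ring R] (M : Matrix m m R) : Prop :=
  ∀ i j, M j i = - M i j

/-- A square integer matrix is homogeneous. -/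
def HomogMat {m : Type*} (A : Matrix m m ℕ) : Prop :=
  ∀ i j l r, A i j + A l r = A i r + A l j

/-- A matrix of polynomials has degree matrix `A`. -/
def DegMat {σ m : Type*} (M : Matrix m m (MvPolynomial σ ℂ)) (A : Matrix m m ℕ) : Prop :=
  ∀ i j, (M i j).IsHomogeneous (A i j)

/-- The set of submaximal Pfaffians of a skew-symmetric matrix of even size `2k`:
Pfaffians of the submatrices obtained by erasing two rows and the two columns
with the same indexes. -/
def submaxPfEven {σ : Type*} {k : ℕ}
    (M : Matrix (Fin (2*k)) (Fin (2*k)) (MvPolynomial σ ℂ)) : Set (MvPolynomial σ ℂ) :=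
  { q | ∃ e : Fin (2*(k-1)) ↪o Fin (2*k), q = pfaff (M.submatrix e e) }

/-- The set of submaximal Pfaffians of a skew-symmetric matrix of odd size `2k-1`:
Pfaffians of the submatrices obtained by erasing one row and the column
with the same index. -/
def submaxPfOdd {σ : Type*} {k : ℕ}
    (M : Matrix (Fin (2*k-1)) (Fin (2*k-1)) (MvPolynomial σ ℂ)) : Set (MvPolynomial σ ℂ) :=
  { q | ∃ e : Fin (2*(k-1)) ↪o Fin (2*k-1), q = pfaff (M.submatrix e e) }

/-- The `i`-th pair of consecutive indices of `Fin (2 * n)`, as a product. -/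
def pairEquiv (n : ℕ) : Fin n × Fin 2 ≃ Fin (2 * n) :=
  finProdFinEquiv.trans (finCongr (Nat.mul_comm n 2))

theorem pairEquiv_val {n : ℕ} (i : Fin n) (x : Fin 2) :
    (pairEquiv n (i, x) : ℕ) = 2 * i + x := by
  simp [pairEquiv, finProdFinEquiv]; ring

theorem sum_pairEquiv {M : Type*} [AddCommMonoid M] {n : ℕ} (f : Fin (2 * n) → M) :
    ∑ j, f j = ∑ i : Fin n, (f (pairEquiv n (i, 0)) + f (pairEquiv n (i, 1))) := by
  rw [← (pairEquiv n).sum_comp, Fintype.sum_prod_type]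
  simp

theorem prod_pairEquiv {M : Type*} [CommMonoid M] {n : ℕ} (f : Fin (2 * n) → M) :
    ∏ j, f j = ∏ i : Fin n, (f (pairEquiv n (i, 0)) * f (pairEquiv n (i, 1))) := by
  rw [← (pairEquiv n).prod_comp, Fintype.prod_prod_type]
  simp

theorem pfaff_eq {σ : Type*} {n : ℕ} (M : Matrix (Fin (2*n)) (Fin (2*n)) (MvPolynomial σ ℂ)) :
    pfaff M = (((2^n * n.factorial : ℕ) : ℂ)⁻¹) •
    ∑ p : Equiv.Perm (Fin (2*n)), (Equiv.Perm.sign p : ℤ) •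
        ∏ i : Fin n, M (p (pairEquiv n (i, 0))) (p (pairEquiv n (i, 1))) := by
  have h0 : ∀ i : Fin n, (⟨2*i.1, by omega⟩ : Fin (2*n)) = pairEquiv n (i, 0) := fun i =>
    Fin.ext (by simp [pairEquiv_val])
  have h1 : ∀ i : Fin n, (⟨2*i.1+1, by omega⟩ : Fin (2*n)) = pairEquiv n (i, 1) := fun i =>
    Fin.ext (by simp [pairEquiv_val])
  simp only [pfaff, h0, h1]

theorem pfaff_scale {σ : Type*} {n : ℕ} (M : Matrix (Fin (2*n)) (Fin (2*n)) (MvPolynomial σ ℂ))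
    (d : Fin (2*n) → MvPolynomial σ ℂ) :
    pfaff (Matrix.of fun i j => d i * d j * M i j) = (∏ j, d j) * pfaff M := by
  rw [pfaff_eq, pfaff_eq, mul_smul_comm, Finset.mul_sum]
  congr 1
  refine Finset.sum_congr rfl fun p _ => ?_
  rw [mul_smul_comm, ← Equiv.prod_comp p d, prod_pairEquiv, ← Finset.prod_mul_distrib]
  rfl

theorem pfaff_isHomogeneous {σ : Type*} {n : ℕ}
    {M : Matrix (Fin (2*n)) (Fin (2*n)) (MvPolynomial σ ℂ)} (c : Fin (2*n) → ℕ) (ε : ℕ)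
    (h : ∀ i j, (M i j).IsHomogeneous (c i + c j + ε)) :
    (pfaff M).IsHomogeneous (∑ j, c j + n * ε) := by
  rw [pfaff_eq, ← mem_homogeneousSubmodule]
  refine Submodule.smul_mem _ _ (Submodule.sum_mem _ fun p _ => ?_)
  refine zsmul_mem ?_ _
  rw [mem_homogeneousSubmodule]
  have := IsHomogeneous.prod Finset.univ
    (fun i : Fin n => M (p (pairEquiv n (i, 0))) (p (pairEquiv n (i, 1)))) _ (fun i _ => h _ _)
  convert this using 1
  rw [← Equiv.sum_comp p c, sum_pairEquiv, Finset.sum_add_distrib (g := fun _ => ε)]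
  simp

/-- The standard symplectic entries on `Fin n × Fin 2`. -/
def sympl {n : ℕ} (a b : Fin n × Fin 2) : ℤ :=
  if a.1 = b.1 then (b.2 : ℤ) - a.2 else 0

theorem sign_eq_prod_sympl {n : ℕ} (q : Equiv.Perm (Fin n × Fin 2))
    (h : ∀ i, (q (i, 0)).1 = (q (i, 1)).1) :
    (Equiv.Perm.sign q : ℤ) = ∏ i, sympl (q (i, 0)) (q (i, 1)) := by
  have hne : ∀ i, (q (i, 0)).2 ≠ (q (i, 1)).2 := fun i hi => by
    have := q.injective (Prod.ext (h i) hi)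
    simp at this
  have hinj : Function.Injective fun i => (q (i, 0)).1 := fun i j hij => by
    have hj := hne j
    by_cases h2 : (q (i, 0)).2 = (q (j, 0)).2
    · have := q.injective (Prod.ext hij h2)
      simpa using this
    · have h3 : (q (i, 0)).2 = (q (j, 1)).2 := by omega
      have := q.injective (Prod.ext (hij.trans (h j)) h3)
      simp at this
  let π : Equiv.Perm (Fin n) := Equiv.ofBijective _ (Finite.injective_iff_bijective.mp hinj)
  let s : Fin n → Equiv.Perm (Fin 2) := fun i =>
    if (q (i, 0)).2 = 0 then 1 else Equiv.swap 0 1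
  have hq : q = (Equiv.prodCongrLeft fun _ : Fin 2 => π) * Equiv.prodCongrRight s := by
    ext1 ⟨i, x⟩
    have := hne i
    have hi := h i
    have hπ : π i = (q (i, 0)).1 := rfl
    simp only [Equiv.Perm.mul_apply, Equiv.prodCongrRight_apply, Equiv.prodCongrLeft_apply, hπ]
    have key : ∀ a b : Fin 2, a ≠ b → a = (if a = 0 then (1 : Equiv.Perm (Fin 2))
      else Equiv.swap 0 1) 0 ∧ b = (if a = 0 then (1 : Equiv.Perm (Fin 2))
      else Equiv.swap 0 1) 1 := by decide
    obtain ⟨k0, k1⟩ := key _ _ this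
    fin_cases x
    · exact Prod.ext rfl k0
    · exact Prod.ext hi.symm k1
  have hsgn : ∀ i, sympl (q (i, 0)) (q (i, 1)) = (Equiv.Perm.sign (s i) : ℤ) := fun i => by
    have key : ∀ a b : Fin 2, a ≠ b → (b : ℤ) - a = (Equiv.Perm.sign (if a = 0 then
      (1 : Equiv.Perm (Fin 2)) else Equiv.swap 0 1) : ℤ) := by decide
    rw [sympl, if_pos (h i)]
    exact key _ _ (hne i)
  rw [Finset.prod_congr rfl fun i _ => hsgn i]
  conv_lhs => rw [hq]
  rw [Equiv.Perm.sign_mul, Equiv.Perm.sign_prodCongrLeft, Equiv.Perm.sign_prodCongrRight]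
  simp

/-- The skew-symmetric tridiagonal matrix with superdiagonal `f 0, f 1, …`. -/
def tridiag {R : Type*} [Ring R] {m : ℕ} (f : ℕ → R) : Matrix (Fin m) (Fin m) R :=
  Matrix.of fun i j => if (j : ℕ) = i + 1 then f i else if (i : ℕ) = j + 1 then - f j else 0

theorem isSkew_tridiag {R : Type*} [Ring R] {m : ℕ} (f : ℕ → R) :
    IsSkew (tridiag f : Matrix (Fin m) (Fin m) R) := by
  intro i j
  simp only [tridiag, Matrix.of_apply]
  split_ifs <;> first | omega | simp

theorem perfect_matching_path {n : ℕ} (τ : ℕ → ℕ)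
    (hinv : ∀ v < 2 * n, τ (τ v) = v)
    (hadj : ∀ v < 2 * n, τ v = v + 1 ∨ v = τ v + 1) (j : ℕ) (hj : j < n) :
    τ (2 * j) = 2 * j + 1 := by
  induction j with
  | zero => rcases hadj 0 (by omega) with h | h <;> omega
  | succ j ih =>
    have ih := ih (by omega)
    rcases hadj (2 * (j + 1)) (by omega) with h | h
    · exact h
    · have h1 := hinv (2 * j) (by omega)
      have h2 := hinv (2 * (j + 1)) (by omega)
      have h3 : τ (2 * (j + 1)) = 2 * j + 1 := by omega
      rw [ih] at h1
      rw [h3] at h2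
      omega

theorem perm_preserves_pairs {n : ℕ} (q : Equiv.Perm (Fin n × Fin 2))
    (h : ∀ i, (pairEquiv n (q (i, 1)) : ℕ) = pairEquiv n (q (i, 0)) + 1 ∨
      (pairEquiv n (q (i, 0)) : ℕ) = pairEquiv n (q (i, 1)) + 1) (i : Fin n) :
    (q (i, 0)).1 = (q (i, 1)).1 := by
  let τ : ℕ → ℕ := fun v => if hv : v < 2 * n then
    pairEquiv n (q (((q.symm ((pairEquiv n).symm ⟨v, hv⟩)).1),
      (q.symm ((pairEquiv n).symm ⟨v, hv⟩)).2 + 1)) else 0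
  have hτ : ∀ j x, τ (pairEquiv n (q (j, x))) = pairEquiv n (q (j, x + 1)) := fun j x => by
    simp [τ]
  have hsurj : ∀ v < 2 * n, ∃ j x, v = pairEquiv n (q (j, x)) := fun v hv => by
    refine ⟨(q.symm ((pairEquiv n).symm ⟨v, hv⟩)).1,
      (q.symm ((pairEquiv n).symm ⟨v, hv⟩)).2, ?_⟩
    simp
  have hm := perfect_matching_path (n := n) τ
    (by
      intro v hv
      obtain ⟨j, x, rfl⟩ := hsurj v hv
      rw [hτ, hτ]
      fin_cases x <;> rfl)
    (by
      intro v hv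
      obtain ⟨j, x, rfl⟩ := hsurj v hv
      rw [hτ]
      fin_cases x
      · exact h j
      · exact (h j).symm)
  have h0 := hτ i 0
  have h1 := hτ i 1
  have hi := h i
  rw [show (0 : Fin 2) + 1 = 1 from rfl] at h0
  rw [show (1 : Fin 2) + 1 = 0 from rfl] at h1
  generalize q (i, 0) = a at *
  generalize q (i, 1) = b at *
  obtain ⟨a, x⟩ := a
  obtain ⟨b, y⟩ := b
  have ha := hm a a.2
  have hb := hm b b.2
  simp only [pairEquiv_val] at h0 h1 hi
  ext
  dsimp only
  fin_cases x <;> fin_cases y <;> simp only [Nat.add_zero] at * <;> omega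

theorem pfaff_tridiag (n : ℕ) : ∃ c : ℂ, c ≠ 0 ∧ ∀ {σ : Type} (f : ℕ → MvPolynomial σ ℂ),
    pfaff (n := n) (tridiag f) = C c * ∏ i : Fin n, f (2 * i) := by
  classical
  let conj : Equiv.Perm (Fin (2 * n)) → Equiv.Perm (Fin n × Fin 2) := fun p =>
    ((pairEquiv n).trans p).trans (pairEquiv n).symm
  let good : Equiv.Perm (Fin (2 * n)) → Prop := fun p =>
    ∀ i, (conj p (i, 0)).1 = (conj p (i, 1)).1
  refine ⟨(((2^n * n.factorial : ℕ) : ℂ)⁻¹) * (Finset.univ.filter good).card, ?_, ?_⟩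
  · refine mul_ne_zero (inv_ne_zero ?_) ?_
    · exact_mod_cast (by positivity : 2^n * n.factorial ≠ 0)
    · have : (1 : Equiv.Perm (Fin (2 * n))) ∈ Finset.univ.filter good :=
        Finset.mem_filter.mpr ⟨Finset.mem_univ _, fun i => by simp [conj]⟩
      exact_mod_cast (Finset.card_pos.mpr ⟨_, this⟩).ne'
  · intro σ f
    have key : ∀ p : Equiv.Perm (Fin (2 * n)), (Equiv.Perm.sign p : ℤ) •
        ∏ i : Fin n, (tridiag f : Matrix (Fin (2*n)) (Fin (2*n)) (MvPolynomial σ ℂ))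
          (p (pairEquiv n (i, 0))) (p (pairEquiv n (i, 1))) =
        if good p then ∏ i : Fin n, f (2 * i) else 0 := by
      intro p
      have hp : ∀ a, p (pairEquiv n a) = pairEquiv n (conj p a) := fun a => by simp [conj]
      split_ifs with hg
      · let d : Fin (2 * n) → MvPolynomial σ ℂ := fun j =>
          if ((pairEquiv n).symm j).2 = 0 then f j else 1
        have hd : ∏ j, d j = ∏ i : Fin n, f (2 * i) := by
          rw [prod_pairEquiv]
          simp [d, pairEquiv_val]
        have hterm : ∀ i : Fin n, (tridiag f : Matrix (Fin (2*n)) (Fin (2*n)) (MvPolynomial σ ℂ))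
            (p (pairEquiv n (i, 0))) (p (pairEquiv n (i, 1))) =
            (d (p (pairEquiv n (i, 0))) * d (p (pairEquiv n (i, 1)))) *
              ((sympl (conj p (i, 0)) (conj p (i, 1)) : ℤ) : MvPolynomial σ ℂ) := by
          intro i
          have hne : conj p (i, 0) ≠ conj p (i, 1) := fun h => by
            have := (conj p).injective h
            simp at this
          have hi := hg i
          rw [hp, hp]
          generalize conj p (i, 0) = a at *
          generalize conj p (i, 1) = b at *
          obtain ⟨a, x⟩ := a
          obtain ⟨b, y⟩ := b
          obtain rfl : a = b := hi
          simp only [d, tridiag, sympl, Matrix.of_apply, pairEquiv_val, Equiv.symm_apply_apply]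
          fin_cases x <;> fin_cases y <;> simp at hne ⊢
          intro hh
          omega
        rw [Finset.prod_congr rfl fun i _ => hterm i, Finset.prod_mul_distrib,
          ← prod_pairEquiv (fun j => d (p j)), Equiv.prod_comp p d, hd, ← Int.cast_prod,
          ← sign_eq_prod_sympl _ hg]
        have hs : Equiv.Perm.sign (conj p) = Equiv.Perm.sign p :=
          Equiv.Perm.sign_symm_trans_trans p (pairEquiv n).symm
        rw [hs, zsmul_eq_mul, mul_comm, mul_assoc, ← Int.cast_mul]
        simp
      · have : ¬ ∀ i, (pairEquiv n (conj p (i, 1)) : ℕ) = pairEquiv n (conj p (i, 0)) + 1 ∨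
            (pairEquiv n (conj p (i, 0)) : ℕ) = pairEquiv n (conj p (i, 1)) + 1 :=
          fun h => hg (perm_preserves_pairs _ h)
        push Not at this
        obtain ⟨i, h1, h2⟩ := this
        rw [Finset.prod_eq_zero (Finset.mem_univ i), smul_zero]
        rw [hp, hp, tridiag, Matrix.of_apply, if_neg h1, if_neg h2]
    rw [pfaff_eq, Finset.sum_congr rfl fun p _ => key p, ← Finset.sum_filter, Finset.sum_const,
      ← Nat.cast_smul_eq_nsmul ℂ, smul_smul, smul_eq_C_mul]

/-- The homogeneous components of members of `I` belong to `I`. -/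
def HomogIdeal {σ : Type*} (I : Ideal (MvPolynomial σ ℂ)) : Prop :=
  ∀ F ∈ I, ∀ d, homogeneousComponent d F ∈ I

theorem homogIdeal_span {σ : Type*} {S : Set (MvPolynomial σ ℂ)}
    (h : ∀ f ∈ S, ∃ e, f.IsHomogeneous e) : HomogIdeal (Ideal.span S) := by
  intro F hF d
  let _ := gradedAlgebra (σ := σ) (R := ℂ)
  have := Ideal.homogeneous_span (homogeneousSubmodule σ ℂ) S h
  have := this d hF
  rwa [← decomposition.decompose'_apply]

theorem HomogIdeal.sup {σ : Type*} {I J : Ideal (MvPolynomial σ ℂ)} (hI : HomogIdeal I)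
    (hJ : HomogIdeal J) : HomogIdeal (I ⊔ J) := by
  intro F hF d
  obtain ⟨a, ha, b, hb, rfl⟩ := Submodule.mem_sup.mp hF
  rw [map_add]
  exact add_mem (Ideal.mem_sup_left (hI a ha d)) (Ideal.mem_sup_right (hJ b hb d))

theorem homogeneousComponent_mul_of_isHomogeneous_one {σ : Type*} {L h : MvPolynomial σ ℂ}
    (hL : L.IsHomogeneous 1) (d : ℕ) :
    homogeneousComponent (d + 1) (L * h) = L * homogeneousComponent d h := by
  conv_lhs => rw [← sum_homogeneousComponent h, Finset.mul_sum, map_sum]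
  have : ∀ i, homogeneousComponent (d + 1) (L * homogeneousComponent i h) =
      if i = d then L * homogeneousComponent i h else 0 := fun i => by
    have := hL.mul (homogeneousComponent_isHomogeneous i h)
    rw [homogeneousComponent_of_mem this]
    congr 1
    simp only [eq_iff_iff]
    omega
  simp only [this, Finset.sum_ite_eq', Finset.mem_range]
  split_ifs with hd
  · rfl
  · rw [homogeneousComponent_eq_zero _ _ (by omega), mul_zero]

theorem HomogIdeal.sub_mul_mem {σ : Type*} {I : Ideal (MvPolynomial σ ℂ)} (hI : HomogIdeal I)
    {L F h : MvPolynomial σ ℂ} (hL : L.IsHomogeneous 1) {d : ℕ} (hF : F.IsHomogeneous (d + 1))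
    (hm : F - L * h ∈ I) : F - L * homogeneousComponent d h ∈ I := by
  have := hI _ hm (d + 1)
  rwa [map_sub, homogeneousComponent_mul_of_isHomogeneous_one hL, homogeneousComponent_of_mem hF,
    if_pos rfl] at this

/-- The ideal `I` contains all forms of degree `d`. -/
def Covers {σ : Type*} (I : Ideal (MvPolynomial σ ℂ)) (d : ℕ) : Prop :=
  ∀ F : MvPolynomial σ ℂ, F.IsHomogeneous d → F ∈ I

theorem Covers.mono {σ : Type*} {I J : Ideal (MvPolynomial σ ℂ)} {d : ℕ} (h : Covers I d)
    (hIJ : I ≤ J) : Covers J d := fun F hF => hIJ (h F hF)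

theorem covers_of_monomial {σ : Type*} {I : Ideal (MvPolynomial σ ℂ)} {d : ℕ}
    (h : ∀ m : σ →₀ ℕ, m.degree = d → monomial m 1 ∈ I) : Covers I d := by
  intro F hF
  rw [F.as_sum]
  refine sum_mem fun m hm => ?_
  rw [← mul_one (coeff m F), ← C_mul_monomial]
  refine Ideal.mul_mem_left _ _ (h m ?_)
  have := hF (mem_support_iff.mp hm)
  rwa [Pi.one_def, ← Finsupp.degree_eq_weight_one] at this

theorem exists_le_sum_eq {ι : Type*} (s : Finset ι) (f : ι → ℕ) (t : ℕ)
    (ht : t ≤ ∑ i ∈ s, f i) : ∃ u : ι → ℕ, (∀ i, u i ≤ f i) ∧ ∑ i ∈ s, u i = t := by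
  classical
  induction s using Finset.induction_on generalizing t with
  | empty =>
    exact ⟨0, fun _ => Nat.zero_le _, by simpa using (Nat.le_zero.mp (by simpa using ht)).symm⟩
  | insert a s ha ih =>
    rw [Finset.sum_insert ha] at ht
    obtain ⟨u, hu, hs⟩ := ih (t - min t (f a)) (by omega)
    refine ⟨Function.update u a (min t (f a)), fun i => ?_, ?_⟩
    · by_cases hi : i = a
      · subst hi; simp
      · simp [hi, hu i]
    · rw [Finset.sum_insert ha, Finset.sum_congr rfl (g := u), hs]
      · simp
      · intro x hx
        rw [Function.update_of_ne]
        rintro rfl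
        exact ha hx

theorem Covers.of_le {σ : Type*} [Fintype σ] {I : Ideal (MvPolynomial σ ℂ)} {d e : ℕ}
    (h : Covers I d) (hde : d ≤ e) : Covers I e := by
  refine covers_of_monomial fun m hm => ?_
  rw [Finsupp.degree_eq_sum] at hm
  obtain ⟨u, hu, hs⟩ := exists_le_sum_eq Finset.univ m d (hm ▸ hde)
  have hm' : m = (m - Finsupp.equivFunOnFinite.symm u) + Finsupp.equivFunOnFinite.symm u := by
    ext i
    have := hu i
    simp only [Finsupp.coe_add, Finsupp.coe_tsub, Finsupp.coe_equivFunOnFinite_symm, Pi.add_apply,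
      Pi.sub_apply]
    omega
  rw [hm', ← one_mul (1 : ℂ), ← monomial_mul]
  refine Ideal.mul_mem_left _ _ (h _ (isHomogeneous_monomial _ ?_))
  simp [Finsupp.degree_eq_sum, hs]

/-- The subalgebra of families of polynomials over `X` whose coefficients are polynomial
functions of the coordinates `φ`. -/
def polyFamilies {X τ : Type*} (φ : X → τ → ℂ) (σ : Type*) :
    Subalgebra ℂ (X → MvPolynomial σ ℂ) where
  carrier := {q | ∀ m, ∃ P : MvPolynomial τ ℂ, ∀ x, coeff m (q x) = eval (φ x) P}
  mul_mem' := by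
    classical
    intro p q hp hq m
    choose P hP using hp
    choose Q hQ using hq
    refine ⟨∑ x ∈ Finset.HasAntidiagonal.antidiagonal m, P x.1 * Q x.2, fun x => ?_⟩
    simp [coeff_mul, hP, hQ]
  add_mem' := by
    intro p q hp hq m
    obtain ⟨P, hP⟩ := hp m
    obtain ⟨Q, hQ⟩ := hq m
    exact ⟨P + Q, fun x => by simp [hP, hQ]⟩
  algebraMap_mem' := by
    intro r m
    exact ⟨C (coeff m (C r)), fun x => by simp [MvPolynomial.algebraMap_eq]⟩

theorem const_mem_polyFamilies {X τ σ : Type*} (φ : X → τ → ℂ) (g : MvPolynomial σ ℂ) :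
    (fun _ => g) ∈ polyFamilies φ σ := fun m => ⟨C (coeff m g), fun x => by simp⟩

theorem pfaff_mem_polyFamilies {X τ σ : Type*} (φ : X → τ → ℂ) {n : ℕ}
    (M : X → Matrix (Fin (2*n)) (Fin (2*n)) (MvPolynomial σ ℂ))
    (h : ∀ i j, (fun x => M x i j) ∈ polyFamilies φ σ) :
    (fun x => pfaff (M x)) ∈ polyFamilies φ σ := by
  have : (fun x => pfaff (M x)) = (((2^n * n.factorial : ℕ) : ℂ)⁻¹) •
    ∑ p : Equiv.Perm (Fin (2*n)), (Equiv.Perm.sign p : ℤ) •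
        ∏ i : Fin n, (fun x => M x (p (pairEquiv n (i, 0))) (p (pairEquiv n (i, 1)))) := by
    ext1 x
    simp [pfaff_eq]
  rw [this]
  exact Subalgebra.smul_mem _ (sum_mem fun p _ => zsmul_mem (prod_mem fun i _ => h _ _) _) _

theorem exists_eval_ne_zero_imp_covers {X τ σ S : Type*} [Finite σ] [Fintype S]
    (φ : X → τ → ℂ) (q : S → X → MvPolynomial σ ℂ) (hq : ∀ s, q s ∈ polyFamilies φ σ)
    (hhom : ∀ s x, ∃ e, (q s x).IsHomogeneous e) {J : Ideal (MvPolynomial σ ℂ)}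
    (hJ : HomogIdeal J) (d : ℕ) (x₀ : X)
    (h : Covers (Ideal.span (Set.range fun s => q s x₀) ⊔ J) d) :
    ∃ P : MvPolynomial τ ℂ, eval (φ x₀) P ≠ 0 ∧
      ∀ x, eval (φ x) P ≠ 0 → Covers (Ideal.span (Set.range fun s => q s x) ⊔ J) d := by
  classical
  let ι := {m : σ →₀ ℕ // m.degree = d}
  have hfin : Finite ι := Finsupp.finite_of_degree_le d |>.subset fun m (hm : m.degree = d) => hm.le
  have := Fintype.ofFinite ι
  have hex : ∀ m : ι, ∃ g : S → MvPolynomial σ ℂ, ∃ a ∈ J,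
      monomial m.1 1 = ∑ s, g s * q s x₀ + a := by
    intro m
    obtain ⟨b, hb, a, ha, hab⟩ := Submodule.mem_sup.mp
      (h (monomial m.1 1) (isHomogeneous_monomial _ m.2))
    obtain ⟨g, hg⟩ := (Ideal.mem_span_range_iff_exists_fun).mp hb
    exact ⟨g, a, ha, by rw [hg, hab]⟩
  choose g a ha hga using hex
  let w : ι → X → MvPolynomial σ ℂ := fun m x => ∑ s, g m s * q s x + a m
  have hw : ∀ m, w m ∈ polyFamilies φ σ := by
    intro m
    have : w m = (∑ s, (fun _ => g m s) * q s) + fun _ => a m := by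
      ext1 x
      simp [w]
    rw [this]
    exact add_mem (sum_mem fun s _ => mul_mem (const_mem_polyFamilies φ _) (hq s))
      (const_mem_polyFamilies φ _)
  have hc : ∀ m m' : ι, ∃ P : MvPolynomial τ ℂ, ∀ x, coeff m'.1 (w m x) = eval (φ x) P :=
    fun m m' => hw m m'.1
  choose N hN using hc
  have hdet : ∀ x, eval (φ x) (Matrix.of N).det =
      (Matrix.of fun m m' : ι => coeff m'.1 (w m x)).det := by
    intro x
    rw [RingHom.map_det]
    congr 1
    ext m m'
    simp [hN]
  refine ⟨(Matrix.of N).det, ?_, ?_⟩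
  · rw [hdet]
    have : (Matrix.of fun m m' : ι => coeff m'.1 (w m x₀)) = 1 := by
      ext m m'
      have : w m x₀ = monomial m.1 1 := (hga m).symm
      simp only [this, Matrix.of_apply, Matrix.one_apply, coeff_monomial]
      exact if_congr Subtype.ext_iff.symm rfl rfl
    simp [this]
  · intro x hx
    rw [hdet] at hx
    set B : Matrix ι ι ℂ := Matrix.of fun m m' : ι => coeff m'.1 (w m x) with hB
    have hinv : B⁻¹ * B = 1 := Matrix.nonsing_inv_mul _ (isUnit_iff_ne_zero.mpr hx)
    have hI : HomogIdeal (Ideal.span (Set.range fun s => q s x) ⊔ J) := by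
      refine (homogIdeal_span ?_).sup hJ
      rintro _ ⟨s, rfl⟩
      exact hhom s x
    have hwI : ∀ m, w m x ∈ Ideal.span (Set.range fun s => q s x) ⊔ J := fun m =>
      add_mem (Ideal.mem_sup_left (sum_mem fun s _ => Ideal.mul_mem_left _ _
        (Ideal.subset_span ⟨s, rfl⟩))) (Ideal.mem_sup_right (ha m))
    refine covers_of_monomial fun m hm => ?_
    have hmem : ∑ m', C (B⁻¹ ⟨m, hm⟩ m') * w m' x ∈ Ideal.span (Set.range fun s => q s x) ⊔ J :=
      sum_mem fun m' _ => Ideal.mul_mem_left _ _ (hwI m')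
    convert hI _ hmem d
    ext k
    rw [coeff_homogeneousComponent]
    split_ifs with hk
    · have := congrFun (congrFun hinv ⟨m, hm⟩) ⟨k, hk⟩
      rw [Matrix.mul_apply] at this
      simp only [coeff_sum, coeff_C_mul]
      rw [coeff_monomial]
      simp only [hB, Matrix.of_apply, Matrix.one_apply, Subtype.mk.injEq] at this
      exact this.symm
    · rw [coeff_monomial, if_neg]
      rintro rfl
      exact hk hm

theorem exists_common_eval_ne_zero {τ : Type*} {P Q : MvPolynomial τ ℂ} {u v : τ → ℂ}
    (hP : eval u P ≠ 0) (hQ : eval v Q ≠ 0) :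
    ∃ t : ℂ, eval (fun i => (1 - t) * u i + t * v i) P ≠ 0 ∧
      eval (fun i => (1 - t) * u i + t * v i) Q ≠ 0 := by
  let ψ : MvPolynomial τ ℂ →ₐ[ℂ] Polynomial ℂ :=
    aeval fun i => (1 - Polynomial.X) * Polynomial.C (u i) + Polynomial.X * Polynomial.C (v i)
  have hψ : ∀ (R : MvPolynomial τ ℂ) (t : ℂ),
      (ψ R).eval t = eval (fun i => (1 - t) * u i + t * v i) R := by
    intro R t
    have : ((Polynomial.evalRingHom t).comp ψ.toRingHom) =
        (eval (fun i => (1 - t) * u i + t * v i)) := by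
      apply MvPolynomial.ringHom_ext
      · intros
        simp [ψ]
      · intros
        simp [ψ]
        ring
    exact congrArg (fun f => f R) this
  have hP0 : ψ P ≠ 0 := fun h => hP (by simpa [h] using (hψ P 0).symm)
  have hQ0 : ψ Q ≠ 0 := fun h => hQ (by simpa [h] using (hψ Q 1).symm)
  obtain ⟨t, ht⟩ : ∃ t, (ψ P * ψ Q).eval t ≠ 0 := by
    by_contra! hall
    exact mul_ne_zero hP0 hQ0 (Polynomial.funext fun t => by simpa using hall t)
  rw [Polynomial.eval_mul, hψ, hψ] at ht
  exact ⟨t, left_ne_zero_of_mul ht, right_ne_zero_of_mul ht⟩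

/-- The Pfaffian of the matrix obtained by erasing the row and column with index `r`. -/
noncomputable def erasedPf {σ : Type*} {K : ℕ}
    (M : Matrix (Fin (2 * K + 1)) (Fin (2 * K + 1)) (MvPolynomial σ ℂ)) (r : Fin (2 * K + 1)) :
    MvPolynomial σ ℂ :=
  pfaff (n := K) (M.submatrix r.succAbove r.succAbove)

/-- Tuples of `K + 1` skew-symmetric matrices of forms, the `(a, b)` entries having degree
`c a + c b + ε`. -/
structure IsSkewTuple {K : ℕ} (c : Fin (2 * K + 1) → ℕ) (ε : ℕ)
    (G : Fin (K + 1) → Matrix (Fin (2 * K + 1)) (Fin (2 * K + 1)) (MvPolynomial (Fin 4) ℂ)) :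
    Prop where
  skew : ∀ i, IsSkew (G i)
  homog : ∀ i a b, (G i a b).IsHomogeneous (c a + c b + ε)

/-- The coefficients of all entries of a tuple of matrices. -/
noncomputable def coords {K : ℕ}
    (G : Fin (K + 1) → Matrix (Fin (2 * K + 1)) (Fin (2 * K + 1)) (MvPolynomial (Fin 4) ℂ)) :
    Fin (K + 1) × Fin (2 * K + 1) × Fin (2 * K + 1) × (Fin 4 →₀ ℕ) → ℂ :=
  fun x => coeff x.2.2.2 (G x.1 x.2.1 x.2.2.1)

theorem IsSkewTuple.erasedPf_isHomogeneous {K : ℕ} {c : Fin (2 * K + 1) → ℕ} {ε : ℕ}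
    {G : Fin (K + 1) → Matrix (Fin (2 * K + 1)) (Fin (2 * K + 1)) (MvPolynomial (Fin 4) ℂ)}
    (hG : IsSkewTuple c ε G) (i : Fin (K + 1)) (r : Fin (2 * K + 1)) :
    (erasedPf (G i) r).IsHomogeneous (∑ j, c (r.succAbove j) + K * ε) :=
  pfaff_isHomogeneous (fun j => c (r.succAbove j)) ε fun _ _ => hG.homog _ _ _

theorem exists_eval_coords_ne_zero_imp_covers {K : ℕ} {c : Fin (2 * K + 1) → ℕ} {ε : ℕ}
    {S : Type*} [Fintype S] (idx : S → Fin (K + 1) × Fin (2 * K + 1))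
    {J : Ideal (MvPolynomial (Fin 4) ℂ)} (hJ : HomogIdeal J) (d : ℕ)
    {G₀ : Fin (K + 1) → Matrix (Fin (2 * K + 1)) (Fin (2 * K + 1)) (MvPolynomial (Fin 4) ℂ)}
    (hG₀ : IsSkewTuple c ε G₀)
    (h : Covers (Ideal.span (Set.range fun s => erasedPf (G₀ (idx s).1) (idx s).2) ⊔ J) d) :
    ∃ P, eval (coords G₀) P ≠ 0 ∧ ∀ G, IsSkewTuple c ε G → eval (coords G) P ≠ 0 →
      Covers (Ideal.span (Set.range fun s => erasedPf (G (idx s).1) (idx s).2) ⊔ J) d := by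
  obtain ⟨P, hP, hall⟩ := exists_eval_ne_zero_imp_covers
    (X := {G : Fin (K + 1) → Matrix (Fin (2 * K + 1)) (Fin (2 * K + 1))
      (MvPolynomial (Fin 4) ℂ) // IsSkewTuple c ε G})
    (fun G => coords G.1) (fun s G => erasedPf (G.1 (idx s).1) (idx s).2)
    (fun s => pfaff_mem_polyFamilies _ _ fun a b m =>
      ⟨X ((idx s).1, (idx s).2.succAbove a, (idx s).2.succAbove b, m), fun G => by
        simp [coords]⟩)
    (fun s G => ⟨_, G.2.erasedPf_isHomogeneous _ _⟩) hJ d ⟨G₀, hG₀⟩ h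
  exact ⟨P, hP, fun G hG hGP => hall ⟨G, hG⟩ hGP⟩

theorem IsSkewTuple.line {K : ℕ} {c : Fin (2 * K + 1) → ℕ} {ε : ℕ}
    {G H : Fin (K + 1) → Matrix (Fin (2 * K + 1)) (Fin (2 * K + 1)) (MvPolynomial (Fin 4) ℂ)}
    (hG : IsSkewTuple c ε G) (hH : IsSkewTuple c ε H) (t : ℂ) :
    IsSkewTuple c ε fun i => Matrix.of fun a b => C (1 - t) * G i a b + C t * H i a b where
  skew i a b := by
    simp only [Matrix.of_apply, hG.skew i a b, hH.skew i a b]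
    ring
  homog i a b := by
    have h1 := (isHomogeneous_C (Fin 4) (1 - t)).mul (hG.homog i a b)
    have h2 := (isHomogeneous_C (Fin 4) t).mul (hH.homog i a b)
    rw [zero_add] at h1 h2
    exact h1.add h2

theorem coords_line {K : ℕ}
    (G H : Fin (K + 1) → Matrix (Fin (2 * K + 1)) (Fin (2 * K + 1)) (MvPolynomial (Fin 4) ℂ))
    (t : ℂ) :
    coords (fun i => Matrix.of fun a b => C (1 - t) * G i a b + C t * H i a b) =
      fun x => (1 - t) * coords G x + t * coords H x := by
  ext x
  simp only [coords, Matrix.of_apply, coeff_add, coeff_C_mul]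

theorem succAbove_val {m : ℕ} (r : Fin (m + 1)) (i : Fin m) :
    (r.succAbove i : ℕ) = if (i : ℕ) < r then (i : ℕ) else i + 1 := by
  simp only [Fin.succAbove, Fin.lt_def, Fin.val_castSucc]
  split_ifs <;> simp

theorem tridiag_submatrix_succAbove {R : Type*} [Ring R] {m : ℕ} (f : ℕ → R) (r : Fin (m + 1)) :
    (tridiag f : Matrix (Fin (m + 1)) (Fin (m + 1)) R).submatrix r.succAbove r.succAbove =
      tridiag fun j => if j + 1 < r then f j else if j + 1 = r then 0 else f (j + 1) := by
  ext i j
  simp only [tridiag, Matrix.submatrix_apply, Matrix.of_apply, succAbove_val]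
  split_ifs <;> first | rfl | omega | simp

theorem monomial_fin_four (m : Fin 4 →₀ ℕ) : (monomial m (1 : ℂ)) =
    X 0 ^ m 0 * X 1 ^ m 1 * X 2 ^ m 2 * X 3 ^ m 3 := by
  rw [monomial_eq, Finsupp.prod_fintype _ _ (by simp), Fin.prod_univ_four]
  simp

theorem monomial_mem_span_X {σ : Type*} {S : Set σ} {m : σ →₀ ℕ} {i : σ} (hi : i ∈ S)
    (hm : m i ≠ 0) : monomial m (1 : ℂ) ∈ Ideal.span (X '' S) :=
  mem_ideal_span_X_image.mpr fun k hk => by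
    classical
    rw [support_monomial, if_neg one_ne_zero, Finset.mem_singleton] at hk
    exact ⟨i, hi, hk ▸ hm⟩

theorem homogIdeal_span_X {σ : Type*} (S : Set σ) :
    HomogIdeal (Ideal.span (X '' S : Set (MvPolynomial σ ℂ))) :=
  homogIdeal_span fun f hf => by
    obtain ⟨i, _, rfl⟩ := hf
    exact ⟨1, isHomogeneous_X _ _⟩

theorem prod_ite_ite {M : Type*} [CommMonoid M] (a b c : M) {l m K : ℕ} (hl : l ≤ m)
    (hm : m ≤ K) :
    ∏ i : Fin K, (if (i : ℕ) < m then if (i : ℕ) < l then a else b else c) =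
      a ^ l * b ^ (m - l) * c ^ (K - m) := by
  rw [Fin.prod_univ_eq_prod_range (fun i => if i < m then if i < l then a else b else c),
    ← Finset.prod_range_mul_prod_Ico _ hm, ← Finset.prod_range_mul_prod_Ico _ hl]
  congr 1
  · congr 1
    · rw [Finset.prod_congr rfl (g := fun _ => a), Finset.prod_const, Finset.card_range]
      intro i hi
      rw [Finset.mem_range] at hi
      rw [if_pos (by omega), if_pos hi]
    · rw [Finset.prod_congr rfl (g := fun _ => b), Finset.prod_const, Nat.card_Ico]
      intro i hi
      rw [Finset.mem_Ico] at hi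
      rw [if_pos (by omega), if_neg (by omega)]
  · rw [Finset.prod_congr rfl (g := fun _ => c), Finset.prod_const, Nat.card_Ico]
    intro i hi
    rw [Finset.mem_Ico] at hi
    rw [if_neg (by omega)]

theorem isHomogeneous_tridiag {m : ℕ} {f : ℕ → MvPolynomial (Fin 4) ℂ} {D : Fin m → Fin m → ℕ}
    (hD : ∀ i j, D i j = D j i)
    (hf : ∀ i j : Fin m, (j : ℕ) = i + 1 → (f i).IsHomogeneous (D i j)) (i j : Fin m) :
    (tridiag f i j).IsHomogeneous (D i j) := by
  simp only [tridiag, Matrix.of_apply]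
  split_ifs with h1 h2
  · exact hf i j h1
  · rw [hD]
    exact (hf j i h2).neg
  · exact isHomogeneous_zero _ _ _

theorem exists_covers_of_zero (K ε : ℕ) (hε : ε ≤ 1) :
    ∃ G, IsSkewTuple (K := K) 0 ε G ∧
      Covers (Ideal.span (Set.range fun s : Fin (K + 1) × Fin (2 * K + 1) =>
        erasedPf (G s.1) s.2) ⊔ Ideal.span (X '' {3})) (K * ε) := by
  let f : ℕ → ℕ → MvPolynomial (Fin 4) ℂ := fun l j =>
    if j % 2 = 1 then X 1 ^ ε else if j < 2 * l then X 2 ^ ε else X 0 ^ ε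
  have hpow : ∀ v : Fin 4, (X v ^ ε : MvPolynomial (Fin 4) ℂ).IsHomogeneous ε := fun v => by
    simpa using (isHomogeneous_X ℂ v).pow ε
  refine ⟨fun l => tridiag (f l), ⟨fun l => isSkew_tridiag _, fun l => ?_⟩, ?_⟩
  · refine isHomogeneous_tridiag (fun _ _ => rfl) fun i j _ => ?_
    simp only [Pi.zero_apply, zero_add, f]
    split_ifs <;> exact hpow _
  · obtain ⟨κ, hκ, hpf⟩ := pfaff_tridiag K
    refine covers_of_monomial fun m hm => ?_
    by_cases h3 : m 3 = 0
    · refine Ideal.mem_sup_left ?_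
      rw [Finsupp.degree_eq_sum, Fin.sum_univ_four, h3] at hm
      obtain ⟨l, t, hl, ht, e2, e0, e1⟩ : ∃ l t, l ≤ t ∧ t ≤ K ∧ ε * l = m 2 ∧
          ε * (t - l) = m 0 ∧ ε * (K - t) = m 1 := by
        interval_cases ε
        · exact ⟨0, 0, by omega⟩
        · exact ⟨m 2, m 2 + m 0, by omega⟩
      have key : erasedPf (tridiag (f l)) (⟨2 * t, by omega⟩ : Fin (2 * K + 1)) =
          C κ * monomial m 1 := by
        rw [erasedPf, tridiag_submatrix_succAbove, hpf]
        congr 1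
        rw [Finset.prod_congr rfl (g := fun i : Fin K =>
          if (i : ℕ) < t then if (i : ℕ) < l then X 2 ^ ε else X 0 ^ ε else X 1 ^ ε),
          prod_ite_ite _ _ _ hl ht, monomial_fin_four, h3, ← e0, ← e1, ← e2]
        · simp only [pow_mul]
          ring
        · intro i _
          simp only [f]
          split_ifs <;> first | rfl | omega
      have hmem : erasedPf (tridiag (f l)) (⟨2 * t, by omega⟩ : Fin (2 * K + 1)) ∈
          Ideal.span (Set.range fun s : Fin (K + 1) × Fin (2 * K + 1) =>
            erasedPf (tridiag (f s.1)) s.2) :=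
        Ideal.subset_span ⟨(⟨l, by omega⟩, ⟨2 * t, by omega⟩), rfl⟩
      rw [key] at hmem
      have := Ideal.mul_mem_left _ (C κ⁻¹) hmem
      rwa [← mul_assoc, ← C_mul, inv_mul_cancel₀ hκ, C_1, one_mul] at this
    · exact Ideal.mem_sup_right (monomial_mem_span_X rfl h3)

/-- Insert a zero row and a zero column with index `r` into a square matrix. -/
def insertZero {R : Type*} [Zero R] {m : ℕ} (r : Fin (m + 1)) (M : Matrix (Fin m) (Fin m) R) :
    Matrix (Fin (m + 1)) (Fin (m + 1)) R :=
  Matrix.of fun a b => r.insertNth (α := fun _ => R) 0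
    (fun i => r.insertNth (α := fun _ => R) 0 (M i) b) a

section insertZero

variable {R : Type*} {m : ℕ} (r : Fin (m + 1)) (M : Matrix (Fin m) (Fin m) R)

@[simp]
theorem insertZero_left [Zero R] (b : Fin (m + 1)) : insertZero r M r b = 0 := by
  simp [insertZero]

@[simp]
theorem insertZero_right [Zero R] (a : Fin (m + 1)) : insertZero r M a r = 0 := by
  rcases Fin.eq_self_or_eq_succAbove r a with rfl | ⟨i, rfl⟩ <;> simp [insertZero]

@[simp]
theorem insertZero_succAbove [Zero R] (i j : Fin m) :
    insertZero r M (r.succAbove i) (r.succAbove j) = M i j := by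
  simp [insertZero]

theorem IsSkew.insertZero [Ring R] {M : Matrix (Fin m) (Fin m) R} (h : IsSkew M) :
    IsSkew (insertZero r M) := by
  intro a b
  rcases Fin.eq_self_or_eq_succAbove r a with rfl | ⟨i, rfl⟩
  · simp
  · rcases Fin.eq_self_or_eq_succAbove r b with rfl | ⟨j, rfl⟩
    · simp
    · simpa using h i j

end insertZero

theorem exists_isSkewTuple_erasedPf_eq {K : ℕ} (c : Fin (2 * K + 1) → ℕ) (ε : ℕ)
    (r : Fin (2 * K + 1)) (s : Fin (K + 1) → ℕ)
    (hs : ∀ i, s i ≤ ∑ j, c (r.succAbove j) + K * ε) :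
    ∃ G, IsSkewTuple c ε G ∧ ∃ κ : ℂ, κ ≠ 0 ∧ ∀ i, erasedPf (G i) r =
      C κ * (X 0 ^ (∑ j, c (r.succAbove j) + K * ε - s i) * X 1 ^ s i) := by
  let deg : Fin K → ℕ := fun j => c (r.succAbove (pairEquiv K (j, 0))) +
    c (r.succAbove (pairEquiv K (j, 1))) + ε
  have hdeg : ∑ j, deg j = ∑ j, c (r.succAbove j) + K * ε := by
    rw [sum_pairEquiv, Finset.sum_add_distrib (g := fun _ => ε)]
    simp
  rw [← hdeg] at hs ⊢
  have hex := fun i => exists_le_sum_eq Finset.univ deg (s i) (hs i)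
  choose u hu hsum using hex
  let F : Fin (K + 1) → Fin K → MvPolynomial (Fin 4) ℂ := fun i j =>
    X 0 ^ (deg j - u i j) * X 1 ^ u i j
  let f : Fin (K + 1) → ℕ → MvPolynomial (Fin 4) ℂ := fun i v =>
    if h : v / 2 < K ∧ v % 2 = 0 then F i ⟨v / 2, h.1⟩ else 0
  have hF : ∀ i j, (F i j).IsHomogeneous (deg j) := fun i j => by
    have := ((isHomogeneous_X ℂ (0 : Fin 4)).pow (deg j - u i j)).mul
      ((isHomogeneous_X ℂ (1 : Fin 4)).pow (u i j))
    convert this using 1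
    have := hu i j
    omega
  obtain ⟨κ, hκ, hpf⟩ := pfaff_tridiag K
  refine ⟨fun i => insertZero r (tridiag (f i)),
    ⟨fun i => (isSkew_tridiag _).insertZero r, fun i a b => ?_⟩, κ, hκ, fun i => ?_⟩
  · rcases Fin.eq_self_or_eq_succAbove r a with rfl | ⟨a, rfl⟩
    · rw [insertZero_left]
      exact isHomogeneous_zero _ _ _
    rcases Fin.eq_self_or_eq_succAbove r b with rfl | ⟨b, rfl⟩
    · rw [insertZero_right]
      exact isHomogeneous_zero _ _ _
    rw [insertZero_succAbove]
    refine isHomogeneous_tridiag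
      (D := fun a b => c (r.succAbove a) + c (r.succAbove b) + ε)
      (fun a b => by ring) (fun a b hab => ?_) a b
    simp only [f]
    split_ifs with h
    · have ha : a = pairEquiv K (⟨a / 2, h.1⟩, 0) :=
        Fin.ext (by rw [pairEquiv_val, Fin.val_zero]; dsimp only; omega)
      have hb : b = pairEquiv K (⟨a / 2, h.1⟩, 1) :=
        Fin.ext (by rw [pairEquiv_val, Fin.val_one]; dsimp only; omega)
      convert hF i ⟨a / 2, h.1⟩ using 1
      simp only [deg, ← ha, ← hb]
    · exact isHomogeneous_zero _ _ _
  · have hsub : (insertZero r (tridiag (f i))).submatrix r.succAbove r.succAbove =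
        tridiag (f i) := by
      ext a b
      simp
    rw [erasedPf, hsub, hpf]
    congr 1
    have : ∀ j : Fin K, f i (2 * j) = F i j := fun j => by
      simp [f]
    rw [Finset.prod_congr rfl fun j _ => this j, Finset.prod_mul_distrib,
      Finset.prod_pow_eq_pow_sum, Finset.prod_pow_eq_pow_sum, hsum]
    congr 2
    rw [Finset.sum_tsub_distrib _ fun j _ => hu i j, hsum]

theorem exists_covers_erasedPf {K : ℕ} (c : Fin (2 * K + 1) → ℕ) (ε : ℕ)
    (r : Fin (2 * K + 1)) (e : ℕ) (he : ∑ j, c (r.succAbove j) + K * ε ≤ K * (e + 1)) :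
    ∃ G, IsSkewTuple c ε G ∧
      Covers (Ideal.span (Set.range fun i : Fin (K + 1) => erasedPf (G i) r) ⊔
        Ideal.span (X '' {2, 3})) (∑ j, c (r.succAbove j) + K * ε + e) := by
  set p := ∑ j, c (r.succAbove j) + K * ε with hp
  obtain ⟨G, hG, κ, hκ, hpf⟩ := exists_isSkewTuple_erasedPf_eq c ε r
    (fun i => min (i * (e + 1)) p) (fun i => min_le_right _ _)
  refine ⟨G, hG, covers_of_monomial fun m hm => ?_⟩
  by_cases h2 : m 2 = 0
  · by_cases h3 : m 3 = 0
    · refine Ideal.mem_sup_left ?_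
      rw [Finsupp.degree_eq_sum, Fin.sum_univ_four, h2, h3] at hm
      obtain ⟨i, hi, h1⟩ : ∃ i : ℕ, i ≤ K ∧ min (i * (e + 1)) p ≤ m 1 ∧
          m 1 ≤ min (i * (e + 1)) p + e := by
        have hdiv := Nat.div_add_mod (m 1) (e + 1)
        have hmod : m 1 % (e + 1) < e + 1 := Nat.mod_lt _ (Nat.succ_pos e)
        rw [mul_comm] at hdiv
        by_cases hle : m 1 / (e + 1) ≤ K
        · exact ⟨m 1 / (e + 1), hle, by omega⟩
        · have := Nat.mul_le_mul_right (e + 1) (not_le.mp hle).le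
          exact ⟨K, le_rfl, by omega⟩
      have hmem : erasedPf (G ⟨i, by omega⟩) r ∈
          Ideal.span (Set.range fun i : Fin (K + 1) => erasedPf (G i) r) :=
        Ideal.subset_span ⟨_, rfl⟩
      rw [hpf, ← hp] at hmem
      dsimp only at hmem
      generalize min (i * (e + 1)) p = s at *
      have := Ideal.mul_mem_left _ (C κ⁻¹ * (X 0 ^ (m 0 - (p - s)) * X 1 ^ (m 1 - s))) hmem
      convert this using 1
      rw [monomial_fin_four, h2, h3]
      have e0 : m 0 = (m 0 - (p - s)) + (p - s) := by omega
      have e1 : m 1 = (m 1 - s) + s := by omega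
      have hκ' : (C κ⁻¹ * C κ : MvPolynomial (Fin 4) ℂ) = 1 := by
        rw [← C_mul, inv_mul_cancel₀ hκ, C_1]
      calc (X 0 ^ m 0 * X 1 ^ m 1 * X 2 ^ 0 * X 3 ^ 0 : MvPolynomial (Fin 4) ℂ) =
            1 * (X 0 ^ ((m 0 - (p - s)) + (p - s)) * X 1 ^ ((m 1 - s) + s)) := by
              rw [← e0, ← e1]
              ring
        _ = _ := by
              rw [← hκ']
              ring
    · exact Ideal.mem_sup_right (monomial_mem_span_X (by simp) h3)
  · exact Ideal.mem_sup_right (monomial_mem_span_X (by simp) h2)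

theorem IsSkewTuple.scale {K : ℕ} {c : Fin (2 * K + 1) → ℕ} {ε : ℕ}
    {G : Fin (K + 1) → Matrix (Fin (2 * K + 1)) (Fin (2 * K + 1)) (MvPolynomial (Fin 4) ℂ)}
    (hG : IsSkewTuple c ε G) {w : Fin (2 * K + 1) → ℕ}
    {d : Fin (2 * K + 1) → MvPolynomial (Fin 4) ℂ}
    (hd : ∀ a, (d a).IsHomogeneous (w a)) :
    IsSkewTuple (c + w) ε fun i => Matrix.of fun a b => d a * d b * G i a b where
  skew i a b := by
    simp only [Matrix.of_apply, hG.skew i a b]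
    ring
  homog i a b := by
    have := ((hd a).mul (hd b)).mul (hG.homog i a b)
    have hw : (c + w) a + (c + w) b + ε = w a + w b + (c a + c b + ε) := by
      simp only [Pi.add_apply]
      ring
    rw [hw]
    exact this

theorem erasedPf_scale {K : ℕ}
    (M : Matrix (Fin (2 * K + 1)) (Fin (2 * K + 1)) (MvPolynomial (Fin 4) ℂ))
    (d : Fin (2 * K + 1) → MvPolynomial (Fin 4) ℂ) (s : Fin (2 * K + 1)) :
    erasedPf (Matrix.of fun a b => d a * d b * M a b) s =
      (∏ j, d (s.succAbove j)) * erasedPf M s :=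
  pfaff_scale (M.submatrix s.succAbove s.succAbove) fun j => d (s.succAbove j)

theorem covers_succ {σ : Type*} {A H I : Ideal (MvPolynomial σ ℂ)} (hH : HomogIdeal H)
    (hHI : H ≤ I) {L : MvPolynomial σ ℂ} (hL : L.IsHomogeneous 1) {D : ℕ} (hA : Covers A D)
    (hAI : ∀ f ∈ A, L * f ∈ I) (hB : Covers (H ⊔ Ideal.span {L}) (D + 1)) :
    Covers I (D + 1) := by
  intro F hF
  obtain ⟨a, ha, b, hb, hab⟩ := Submodule.mem_sup.mp (hB F hF)
  obtain ⟨g, rfl⟩ := Ideal.mem_span_singleton.mp hb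
  have hg : F - L * g ∈ H := by
    rw [← hab]
    simpa using ha
  have h1 := hHI (hH.sub_mul_mem hL hF hg)
  have h2 := hAI _ (hA _ (homogeneousComponent_isHomogeneous D g))
  simpa using add_mem h1 h2

theorem exists_covers_scale {K : ℕ} {c : Fin (2 * K + 1) → ℕ} {ε D : ℕ} (r : Fin (2 * K + 1))
    {G : Fin (K + 1) → Matrix (Fin (2 * K + 1)) (Fin (2 * K + 1)) (MvPolynomial (Fin 4) ℂ)}
    (hG : IsSkewTuple c ε G)
    (hA : Covers (Ideal.span (Set.range fun s : Fin (K + 1) × Fin (2 * K + 1) =>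
        erasedPf (G s.1) s.2) ⊔ Ideal.span (X '' {3})) D)
    (hB : Covers (Ideal.span (Set.range fun i : Fin (K + 1) => erasedPf (G i) r) ⊔
        Ideal.span (X '' {2, 3})) (D + 1)) :
    ∃ G', IsSkewTuple (c + Pi.single r 1) ε G' ∧
      Covers (Ideal.span (Set.range fun s : Fin (K + 1) × Fin (2 * K + 1) =>
        erasedPf (G' s.1) s.2) ⊔ Ideal.span (X '' {3})) (D + 1) := by
  let d : Fin (2 * K + 1) → MvPolynomial (Fin 4) ℂ := Function.update 1 r (X 2)
  have hd : ∀ a, (d a).IsHomogeneous ((Pi.single r 1 : Fin (2 * K + 1) → ℕ) a) := by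
    intro a
    by_cases ha : a = r
    · subst ha
      simpa [d] using isHomogeneous_X ℂ 2
    · simpa [d, ha] using isHomogeneous_one (Fin 4) ℂ
  refine ⟨_, hG.scale hd, fun F hF => ?_⟩
  set I := Ideal.span (Set.range fun s : Fin (K + 1) × Fin (2 * K + 1) =>
    erasedPf (Matrix.of fun a b => d a * d b * G s.1 a b) s.2) ⊔ Ideal.span (X '' {3}) with hI
  have hr : ∀ i, erasedPf (G i) r ∈ I := fun i => by
    have : erasedPf (Matrix.of fun a b => d a * d b * G i a b) r ∈ I :=
      Ideal.mem_sup_left (Ideal.subset_span ⟨(i, r), rfl⟩)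
    rw [erasedPf_scale, Finset.prod_congr rfl (g := fun _ => 1)] at this
    · simpa using this
    · intro j _
      simp [d, Fin.succAbove_ne]
  have hall : ∀ i s, X 2 * erasedPf (G i) s ∈ I := fun i s => by
    by_cases hs : s = r
    · exact hs ▸ Ideal.mul_mem_left _ _ (hr i)
    · have : erasedPf (Matrix.of fun a b => d a * d b * G i a b) s ∈ I :=
        Ideal.mem_sup_left (Ideal.subset_span ⟨(i, s), rfl⟩)
      obtain ⟨j, hj⟩ := Fin.exists_succAbove_eq (Ne.symm hs)
      rw [erasedPf_scale, Finset.prod_eq_single j] at this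
      · simpa [d, hj] using this
      · intro k _ hk
        have : s.succAbove k ≠ r := fun h => hk (Fin.succAbove_right_injective (h.trans hj.symm))
        simp [d, this]
      · simp
  have hX3 : (X 3 : MvPolynomial (Fin 4) ℂ) ∈ Ideal.span (X '' ({3} : Set (Fin 4))) :=
    Ideal.subset_span (Set.mem_image_of_mem X (Set.mem_singleton 3))
  have hHhom : HomogIdeal (Ideal.span (Set.range fun i => erasedPf (G i) r) ⊔
      Ideal.span (X '' ({3} : Set (Fin 4)))) := by
    refine (homogIdeal_span ?_).sup (homogIdeal_span_X _)
    rintro _ ⟨i, rfl⟩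
    exact ⟨_, hG.erasedPf_isHomogeneous i r⟩
  refine covers_succ hHhom (sup_le (Ideal.span_le.mpr ?_) le_sup_right) (isHomogeneous_X ℂ 2) hA
    ?_ (hB.mono (sup_le (le_sup_left.trans le_sup_left) (Ideal.span_le.mpr ?_))) F hF
  · rintro _ ⟨i, rfl⟩
    exact hr i
  · intro f hf
    obtain ⟨a, ha, b, hb, rfl⟩ := Submodule.mem_sup.mp hf
    rw [mul_add]
    refine add_mem ?_ (Ideal.mul_mem_left _ _ (Ideal.mem_sup_right hb))
    obtain ⟨u, rfl⟩ := Ideal.mem_span_range_iff_exists_fun.mp ha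
    rw [Finset.mul_sum]
    refine sum_mem fun s _ => ?_
    rw [mul_left_comm]
    exact Ideal.mul_mem_left _ _ (hall _ _)
  · rw [Set.image_pair]
    rintro _ (rfl | rfl)
    · exact Ideal.mem_sup_right (Ideal.mem_span_singleton_self _)
    · exact Ideal.mem_sup_left (Ideal.mem_sup_right hX3)

theorem exists_common_covers {K : ℕ} {c : Fin (2 * K + 1) → ℕ} {ε : ℕ} {S₁ S₂ : Type*}
    [Fintype S₁] [Fintype S₂] (idx₁ : S₁ → Fin (K + 1) × Fin (2 * K + 1))
    (idx₂ : S₂ → Fin (K + 1) × Fin (2 * K + 1)) {J₁ J₂ : Ideal (MvPolynomial (Fin 4) ℂ)}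
    (hJ₁ : HomogIdeal J₁) (hJ₂ : HomogIdeal J₂) {d₁ d₂ : ℕ}
    {G₁ G₂ : Fin (K + 1) → Matrix (Fin (2 * K + 1)) (Fin (2 * K + 1)) (MvPolynomial (Fin 4) ℂ)}
    (hG₁ : IsSkewTuple c ε G₁) (hG₂ : IsSkewTuple c ε G₂)
    (h₁ : Covers (Ideal.span (Set.range fun s => erasedPf (G₁ (idx₁ s).1) (idx₁ s).2) ⊔ J₁) d₁)
    (h₂ : Covers (Ideal.span (Set.range fun s => erasedPf (G₂ (idx₂ s).1) (idx₂ s).2) ⊔ J₂) d₂) :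
    ∃ G, IsSkewTuple c ε G ∧
      Covers (Ideal.span (Set.range fun s => erasedPf (G (idx₁ s).1) (idx₁ s).2) ⊔ J₁) d₁ ∧
      Covers (Ideal.span (Set.range fun s => erasedPf (G (idx₂ s).1) (idx₂ s).2) ⊔ J₂) d₂ := by
  obtain ⟨P, hP, hPall⟩ := exists_eval_coords_ne_zero_imp_covers idx₁ hJ₁ d₁ hG₁ h₁
  obtain ⟨Q, hQ, hQall⟩ := exists_eval_coords_ne_zero_imp_covers idx₂ hJ₂ d₂ hG₂ h₂
  obtain ⟨t, hPt, hQt⟩ := exists_common_eval_ne_zero hP hQ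
  obtain ⟨G, hG, hcoords⟩ : ∃ G, IsSkewTuple c ε G ∧
      coords G = fun x => (1 - t) * coords G₁ x + t * coords G₂ x :=
    ⟨_, hG₁.line hG₂ t, coords_line G₁ G₂ t⟩
  rw [← hcoords] at hPt hQt
  exact ⟨G, hG, hPall G hG hPt, hQall G hG hQt⟩

theorem exists_covers_add_single {K : ℕ} {c : Fin (2 * K + 1) → ℕ} {ε m D : ℕ}
    (r : Fin (2 * K + 1)) (hmax : ∀ i, c i ≤ c r + 1) (hm : c r + 1 ≤ m)
    (hD : D = m + ∑ i, c i + (K + 1) * ε)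
    {G₁ : Fin (K + 1) → Matrix (Fin (2 * K + 1)) (Fin (2 * K + 1)) (MvPolynomial (Fin 4) ℂ)}
    (hG₁ : IsSkewTuple c ε G₁)
    (h₁ : Covers (Ideal.span (Set.range fun s : Fin (K + 1) × Fin (2 * K + 1) =>
        erasedPf (G₁ s.1) s.2) ⊔ Ideal.span (X '' {3})) D) :
    ∃ G, IsSkewTuple (c + Pi.single r 1) ε G ∧
      Covers (Ideal.span (Set.range fun s : Fin (K + 1) × Fin (2 * K + 1) =>
        erasedPf (G s.1) s.2) ⊔ Ideal.span (X '' {3})) (D + 1) := by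
  have hsum : ∑ i, c i = c r + ∑ j, c (r.succAbove j) := Fin.sum_univ_succAbove c r
  have hbound : ∑ j, c (r.succAbove j) ≤ 2 * K * (c r + 1) := by
    simpa using Finset.sum_le_card_nsmul Finset.univ (fun j => c (r.succAbove j)) (c r + 1)
      fun j _ => hmax _
  obtain ⟨G₂, hG₂, h₂⟩ := exists_covers_erasedPf c ε r (m + c r + ε + 1) (by nlinarith)
  have hdeg : ∑ j, c (r.succAbove j) + K * ε + (m + c r + ε + 1) =
      D + 1 := by
    rw [hD, hsum]
    ring
  rw [hdeg] at h₂
  obtain ⟨G, hG, hA, hB⟩ := exists_common_covers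
    (fun s : Fin (K + 1) × Fin (2 * K + 1) => (s.1, s.2)) (fun i => (i, r))
    (homogIdeal_span_X {3}) (homogIdeal_span_X {2, 3}) hG₁ hG₂ h₁ h₂
  exact exists_covers_scale r hG hA hB

theorem exists_covers {K : ℕ} (c : Fin (2 * K + 1) → ℕ) (ε m : ℕ) (hε : ε ≤ 1)
    (hm : ∀ i, c i ≤ m) :
    ∃ G, IsSkewTuple c ε G ∧
      Covers (Ideal.span (Set.range fun s : Fin (K + 1) × Fin (2 * K + 1) =>
        erasedPf (G s.1) s.2) ⊔ Ideal.span (X '' {3})) (m + ∑ i, c i + (K + 1) * ε) := by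
  induction hN : ∑ i, c i generalizing c with
  | zero =>
    have hc : c = 0 := by
      ext i
      exact Finset.sum_eq_zero_iff.mp hN i (Finset.mem_univ _)
    subst hc
    obtain ⟨G, hG, hcov⟩ := exists_covers_of_zero K ε hε
    exact ⟨G, hG, hcov.of_le (by nlinarith)⟩
  | succ N ih =>
    obtain ⟨r, -, hr⟩ := Finset.exists_max_image Finset.univ c Finset.univ_nonempty
    have hpos : 1 ≤ c r := by
      by_contra! h0
      have : ∑ i, c i = 0 := Finset.sum_eq_zero fun i hi => by
        have := hr i hi
        omega
      omega
    set c' : Fin (2 * K + 1) → ℕ := Function.update c r (c r - 1) with hc'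
    have hcc : c = c' + Pi.single r 1 := by
      ext i
      by_cases hi : i = r
      · subst hi
        simp [hc']
        omega
      · simp [hc', hi]
    have hle : ∀ i, c' i ≤ c i := fun i => by
      rw [hcc]
      simp
    have hsum : ∑ i, c' i = N := by
      rw [hcc] at hN
      simp only [Pi.add_apply, Finset.sum_add_distrib, Finset.sum_pi_single',
        Finset.mem_univ, if_true] at hN
      omega
    have hcr : c' r + 1 = c r := by
      simp [hc']
      omega
    obtain ⟨G₁, hG₁, h₁⟩ := ih c' (fun i => (hle i).trans (hm i)) hsum
    rw [← hsum] at h₁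
    obtain ⟨G, hG, hcov⟩ := exists_covers_add_single r
      (fun i => (hle i).trans (hcr ▸ hr i (Finset.mem_univ _))) (hcr ▸ hm r) rfl hG₁ h₁
    rw [← hcc] at hG
    refine ⟨G, hG, ?_⟩
    rw [hsum] at hcov
    convert hcov using 1
    ring

theorem HomogMat.exists_eq_add {m : Type*} {A : Matrix m m ℕ} (hsym : A.IsSymm)
    (hhom : HomogMat A) (o : m) (hord : ∀ j, A j o ≤ A o o) :
    ∃ (c : m → ℕ) (ε : ℕ), ε ≤ 1 ∧ (∀ i j, A i j = c i + c j + ε) ∧ ∀ j, c j ≤ c o := by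
  have hdiag : ∀ i j, 2 * A i j = A i i + A j j := fun i j => by
    have h1 := hhom i j j i
    have h2 := hsym.apply i j
    omega
  refine ⟨fun i => A i i / 2, A o o % 2, by omega, fun i j => ?_, fun j => ?_⟩
  · have := hdiag i j
    have := hdiag i o
    have := hdiag j o
    dsimp only
    omega
  · have := hdiag j o
    have := hord j
    exact Nat.div_le_div_right (by omega)

theorem HomogIdeal.exists_sub_mul_mem {σ : Type*} {I : Ideal (MvPolynomial σ ℂ)}
    (hI : HomogIdeal I) {L F : MvPolynomial σ ℂ} (hL : L.IsHomogeneous 1) {d : ℕ}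
    (hF : F.IsHomogeneous d) (hm : F ∈ Ideal.span {L} ⊔ I) :
    ∃ g : MvPolynomial σ ℂ, g.IsHomogeneous (d - 1) ∧ F - L * g ∈ I := by
  obtain ⟨a, ha, b, hb, rfl⟩ := Submodule.mem_sup.mp hm
  obtain ⟨h, rfl⟩ := Ideal.mem_span_singleton.mp ha
  have hsub : L * h + b - L * h ∈ I := by simpa using hb
  cases d with
  | zero =>
    refine ⟨0, isHomogeneous_zero _ _ _, ?_⟩
    have h0 := hI _ hsub 0
    have hL0 : coeff 0 L = 0 := hL.coeff_eq_zero (by simp)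
    rw [map_sub, homogeneousComponent_of_mem hF, if_pos rfl, homogeneousComponent_zero,
      ← constantCoeff_eq, map_mul, constantCoeff_eq, hL0, zero_mul, C_0, sub_zero] at h0
    simpa using h0
  | succ d =>
    exact ⟨_, homogeneousComponent_isHomogeneous d h, hI.sub_mul_mem hL hF hsub⟩

/-- For a general linear form `L`, the ideal `(L) + I` contains all forms of degree `d`,
as soon as this holds for one linear form. -/
theorem HomogIdeal.exists_eval_coeff_ne_zero_imp_covers {σ : Type*} [Finite σ]
    {I : Ideal (MvPolynomial σ ℂ)} (hI : HomogIdeal I) {d : ℕ} {L₀ : MvPolynomial σ ℂ}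
    (hL₀ : L₀.IsHomogeneous 1) (h : Covers (Ideal.span {L₀} ⊔ I) d) :
    ∃ Q : MvPolynomial (σ →₀ ℕ) ℂ, eval (fun m => coeff m L₀) Q ≠ 0 ∧
      ∀ L : MvPolynomial σ ℂ, L.IsHomogeneous 1 → eval (fun m => coeff m L) Q ≠ 0 →
        Covers (Ideal.span {L} ⊔ I) d := by
  obtain ⟨Q, hQ, hall⟩ := exists_eval_ne_zero_imp_covers
    (X := {L : MvPolynomial σ ℂ // L.IsHomogeneous 1}) (fun L m => coeff m L.1)
    (fun (_ : Unit) L => L.1) (fun _ m => ⟨X m, fun L => by simp⟩) (fun _ L => ⟨1, L.2⟩) hI d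
    ⟨L₀, hL₀⟩ (by simpa only [Set.range_const] using h)
  refine ⟨Q, hQ, fun L hL hLQ => ?_⟩
  simpa only [Set.range_const] using hall ⟨L, hL⟩ hLQ

theorem erasedPf_mem_submaxPfOdd {σ : Type*} {K : ℕ}
    (M : Matrix (Fin (2 * K + 1)) (Fin (2 * K + 1)) (MvPolynomial σ ℂ)) (r : Fin (2 * K + 1)) :
    erasedPf M r ∈ submaxPfOdd (k := K + 1) M :=
  ⟨Fin.succAboveOrderEmb r, rfl⟩

/-- Let `A` be a non-negative, ordered, symmetric, homogeneous integer
matrix of odd size `(2k-1) × (2k-1)`, `k > 1`. For a general choice of `k` skew-symmetric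
matrices `G 0, …, G (k-1)` of forms in four variables with degree matrix `A`, and `I` the
ideal generated by the submaximal Pfaffians of all the `G i`, multiplication by a general
linear form `L` gives a surjection `(R/I)_{d-1} → (R/I)_d` for all
`d ≥ (a₁₁ + tr A)/2`. Genericity (for the tuple `G` and then for `L`) is expressed by
nonzero polynomials in the coefficients, cutting out nonempty Zariski-open subsets. -/
theorem mult_by_general_linear_form_surjective_modulo_odd_pfaffian_ideal_four_vars
    (k : ℕ) (hk : 1 < k)
    (A : Matrix (Fin (2*k-1)) (Fin (2*k-1)) ℕ) (hsym : A.IsSymm) (hhom : HomogMat A)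
    (hord : ∀ i j : Fin (2*k-1), i ≤ j → A j ⟨0, by omega⟩ ≤ A i ⟨0, by omega⟩) :
    ∃ P : MvPolynomial (Fin k × Fin (2*k-1) × Fin (2*k-1) × ((Fin 4) →₀ ℕ)) ℂ, P ≠ 0 ∧
      (∃ G : Fin k → Matrix (Fin (2*k-1)) (Fin (2*k-1)) (MvPolynomial (Fin 4) ℂ),
        (∀ i, IsSkew (G i)) ∧ (∀ i, DegMat (G i) A) ∧
        MvPolynomial.eval
          (fun x => MvPolynomial.coeff x.2.2.2 (G x.1 x.2.1 x.2.2.1)) P ≠ 0) ∧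
      ∀ G : Fin k → Matrix (Fin (2*k-1)) (Fin (2*k-1)) (MvPolynomial (Fin 4) ℂ),
        (∀ i, IsSkew (G i)) → (∀ i, DegMat (G i) A) →
        MvPolynomial.eval
          (fun x => MvPolynomial.coeff x.2.2.2 (G x.1 x.2.1 x.2.2.1)) P ≠ 0 →
        ∃ Q : MvPolynomial ((Fin 4) →₀ ℕ) ℂ, Q ≠ 0 ∧
          (∃ L : MvPolynomial (Fin 4) ℂ, L.IsHomogeneous 1 ∧
            MvPolynomial.eval (fun m => MvPolynomial.coeff m L) Q ≠ 0) ∧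
          ∀ L : MvPolynomial (Fin 4) ℂ, L.IsHomogeneous 1 →
            MvPolynomial.eval (fun m => MvPolynomial.coeff m L) Q ≠ 0 →
            ∀ d : ℕ, A ⟨0, by omega⟩ ⟨0, by omega⟩ + Matrix.trace A ≤ 2 * d →
              ∀ F : MvPolynomial (Fin 4) ℂ, F.IsHomogeneous d →
                ∃ G' : MvPolynomial (Fin 4) ℂ, G'.IsHomogeneous (d - 1) ∧
                  F - L * G' ∈ Ideal.span (⋃ i, submaxPfOdd (G i)) := by
  obtain ⟨K, rfl⟩ : ∃ K, k = K + 1 := ⟨k - 1, by omega⟩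
  obtain ⟨c, ε, hε, hA, hc⟩ := hhom.exists_eq_add hsym ⟨0, by omega⟩
    fun j => hord _ _ (Nat.zero_le _)
  change Fin (2 * K + 1) → ℕ at c
  set m := c ⟨0, by omega⟩ with hm
  have htuple : ∀ G : Fin (K + 1) → Matrix (Fin (2 * K + 1)) (Fin (2 * K + 1))
      (MvPolynomial (Fin 4) ℂ),
      (∀ i, IsSkew (G i)) → (∀ i, DegMat (G i) A) → IsSkewTuple c ε G :=
    fun G hs hd => ⟨hs, fun i a b => hA a b ▸ hd i a b⟩
  obtain ⟨G₀, hG₀, h₀⟩ := exists_covers c ε m hε hc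
  obtain ⟨P, hP, hPall⟩ := exists_eval_coords_ne_zero_imp_covers
    (fun s : Fin (K + 1) × Fin (2 * K + 1) => (s.1, s.2)) (homogIdeal_span_X {3}) _ hG₀ h₀
  refine ⟨P, ?_, ⟨G₀, hG₀.skew, fun i a b => ?_, hP⟩, fun G hs hd hGP => ?_⟩
  · rintro rfl
    exact hP (map_zero _)
  · rw [hA]
    exact hG₀.homog i a b
  have hG := htuple G hs hd
  have hcov := hPall G hG hGP
  rw [sup_comm, Set.image_singleton] at hcov
  have hI : HomogIdeal (Ideal.span (Set.range fun s : Fin (K + 1) × Fin (2 * K + 1) =>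
      erasedPf (G s.1) s.2)) := by
    refine homogIdeal_span ?_
    rintro _ ⟨s, rfl⟩
    exact ⟨_, hG.erasedPf_isHomogeneous _ _⟩
  have hle : Ideal.span (Set.range fun s : Fin (K + 1) × Fin (2 * K + 1) =>
      erasedPf (G s.1) s.2) ≤ Ideal.span (⋃ i, submaxPfOdd (G i)) := by
    refine Ideal.span_mono ?_
    rintro _ ⟨s, rfl⟩
    exact Set.mem_iUnion.mpr ⟨s.1, erasedPf_mem_submaxPfOdd _ _⟩
  obtain ⟨Q, hQ, hQall⟩ := hI.exists_eval_coeff_ne_zero_imp_covers (isHomogeneous_X ℂ 3) hcov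
  refine ⟨Q, ?_, ⟨X 3, isHomogeneous_X ℂ 3, hQ⟩, fun L hL hLQ d hdeg F hF => ?_⟩
  · rintro rfl
    exact hQ (map_zero _)
  have htrace : A.trace = ∑ i, (2 * c i + ε) :=
    Finset.sum_congr rfl fun i _ => by
      rw [Matrix.diag_apply, hA]
      ring
  have hD : m + ∑ i, c i + (K + 1) * ε ≤ d := by
    rw [htrace, hA, Finset.sum_add_distrib, ← Finset.mul_sum, Finset.sum_const, Finset.card_univ,
      Fintype.card_fin, smul_eq_mul, ← hm] at hdeg
    nlinarith
  obtain ⟨g, hg, hmem⟩ := hI.exists_sub_mul_mem hL hF ((hQall L hL hLQ).of_le hD F hF)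
  exact ⟨g, hg, hle hmem⟩
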